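/- arXiv:1612.00072 — 4 statements merged into one kernel-verified Lean document; each statement's English description precedes it below -/
import Mathlib

section
/- Let E be a nonempty set and let A : (E → ℝ) → ℝ be an isotonic linear functional. Let p : E → ℝ be a non-negative function and let f, g : E → ℝ be similarly ordered functions. Then A(p)·A(p·f·g) ≥ A(p·f)·A(p·g). If f and g are oppositely ordered, then the reversed inequality holds. -/
/-- A map preserving binary linear combinations preserves four-term ones. -/
theorem map_four_term_combination {E : Type*} {A : (E → ℝ) → ℝ}
    (hAlin : ∀ (f g : E → ℝ) (a b : ℝ), A (fun t => a * f t + b * g t) = a * A f + b * A g)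
    (u v w z : E → ℝ) (a b c d : ℝ) :
    A (fun t => a * u t + b * v t + (c * w t + d * z t)) =
      a * A u + b * A v + (c * A w + d * A z) := by
  have h := hAlin (fun t => a * u t + b * v t) (fun t => c * w t + d * z t) 1 1
  simpa only [one_mul, hAlin] using h

/-- Chebyshev's inequality for isotonic linear functionals and similarly ordered functions. -/
theorem chebyshev_of_similarly_ordered {E : Type*} {A : (E → ℝ) → ℝ}
    (hAlin : ∀ (f g : E → ℝ) (a b : ℝ), A (fun t => a * f t + b * g t) = a * A f + b * A g)
    (hAmono : ∀ f : E → ℝ, (∀ t, (0 : ℝ) ≤ f t) → 0 ≤ A f)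
    {p f g : E → ℝ} (hp : ∀ t, 0 ≤ p t) (hfg : ∀ x y, 0 ≤ (f x - f y) * (g x - g y)) :
    A (fun t => p t * f t) * A (fun t => p t * g t) ≤
      A p * A (fun t => p t * f t * g t) := by
  have expand := map_four_term_combination hAlin (fun t => p t * f t * g t)
    (fun t => p t * f t) (fun t => p t * g t) p
  have inner (y : E) : 0 ≤ 1 * A (fun t => p t * f t * g t) + -g y * A (fun t => p t * f t) +
      (-f y * A (fun t => p t * g t) + f y * g y * A p) := by
    rw [← expand]
    refine hAmono _ fun t => ?_
    linear_combination mul_nonneg (hp t) (hfg t y)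
  have outer : 0 ≤ A (fun t => A p * (p t * f t * g t) + -A (fun t => p t * g t) * (p t * f t) +
      (-A (fun t => p t * f t) * (p t * g t) + A (fun t => p t * f t * g t) * p t)) := by
    refine hAmono _ fun t => ?_
    linear_combination mul_nonneg (hp t) (inner t)
  rw [expand] at outer
  linarith

theorem stmt_1 {E : Type*} [Nonempty E]
    (A : (E → ℝ) → ℝ)
    (hAlin : ∀ (f g : E → ℝ) (a b : ℝ), A (fun t => a * f t + b * g t) = a * A f + b * A g)
    (hAmono : ∀ f : E → ℝ, (∀ t, (0:ℝ) ≤ f t) → 0 ≤ A f)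
    (p f g : E → ℝ) (hp : ∀ t, 0 ≤ p t) :
    ((∀ x y, 0 ≤ (f x - f y) * (g x - g y)) →
      A p * A (fun t => p t * f t * g t) ≥
        A (fun t => p t * f t) * A (fun t => p t * g t)) ∧
    ((∀ x y, (f x - f y) * (g x - g y) ≤ 0) →
      A p * A (fun t => p t * f t * g t) ≤
        A (fun t => p t * f t) * A (fun t => p t * g t)) := by
  refine ⟨chebyshev_of_similarly_ordered hAlin hAmono hp, fun hfg => ?_⟩
  have hneg (u : E → ℝ) : A (fun t => -u t) = -A u := by
    simpa using hAlin u u (-1) 0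
  have h := chebyshev_of_similarly_ordered hAlin hAmono (f := f) (g := fun t => -g t) hp
    fun x y => by linear_combination hfg x y
  simp only [mul_neg, hneg] at h
  linarith
end

section
/- Let E be a nonempty set and let A, B : (E → ℝ) → ℝ be isotonic linear functionals. Let p, q : E → ℝ be non-negative functions, let m, M, n, N, k, K ∈ ℝ, and let f, g, h : E → ℝ satisfy m ≤ f(x) ≤ M, n ≤ g(x) ≤ N, and k ≤ h(x) ≤ K for all x ∈ E. Then |A(p·f·g·h)·B(q) + A(p·f)·B(q·g·h) + A(p·g)·B(q·f·h) + A(p·h)·B(q·f·g) − A(p·f·g)·B(q·h) − A(p·f·h)·B(q·g) − A(p·g·h)·B(q·f) − A(p)·B(q·f·g·h)| ≤ (M−m)·(N−n)·(K−k)·A(p)·B(q). -/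
/-- The value at a nonnegative kernel `p x * q y * (C + s * (f x - f y) * (g x - g y) * (h x - h y))`
of the product of two positive linear functionals is nonnegative. -/
theorem nonneg_triple_difference {E : Type*} (A B : (E → ℝ) →ₗ[ℝ] ℝ)
    (hA : ∀ f : E → ℝ, (∀ t, 0 ≤ f t) → 0 ≤ A f)
    (hB : ∀ f : E → ℝ, (∀ t, 0 ≤ f t) → 0 ≤ B f)
    (p q f g h : E → ℝ) (hp : ∀ t, 0 ≤ p t) (hq : ∀ t, 0 ≤ q t) (C s : ℝ)
    (hC : ∀ x y, 0 ≤ C + s * ((f x - f y) * (g x - g y) * (h x - h y))) :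
    0 ≤ C * (A p * B q) + s *
      (A (fun t => p t * f t * g t * h t) * B q +
      A (fun t => p t * f t) * B (fun t => q t * g t * h t) +
      A (fun t => p t * g t) * B (fun t => q t * f t * h t) +
      A (fun t => p t * h t) * B (fun t => q t * f t * g t) -
      A (fun t => p t * f t * g t) * B (fun t => q t * h t) -
      A (fun t => p t * f t * h t) * B (fun t => q t * g t) -
      A (fun t => p t * g t * h t) * B (fun t => q t * f t) -
      A p * B (fun t => q t * f t * g t * h t)) := by
  have inner (y : E) : 0 ≤ (C - s * (f y * g y * h y)) * A p +
      s * (A (fun t => p t * f t * g t * h t) +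
      g y * h y * A (fun t => p t * f t) + f y * h y * A (fun t => p t * g t) +
      f y * g y * A (fun t => p t * h t) - h y * A (fun t => p t * f t * g t) -
      g y * A (fun t => p t * f t * h t) - f y * A (fun t => p t * g t * h t)) := by
    have key := hA ((C - s * (f y * g y * h y)) • p +
      s • ((fun t => p t * f t * g t * h t) +
      (g y * h y) • (fun t => p t * f t) + (f y * h y) • (fun t => p t * g t) +
      (f y * g y) • (fun t => p t * h t) - h y • (fun t => p t * f t * g t) -
      g y • (fun t => p t * f t * h t) - f y • (fun t => p t * g t * h t))) fun x => by
        have := mul_nonneg (hp x) (hC x y)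
        simp only [Pi.add_apply, Pi.sub_apply, Pi.smul_apply, smul_eq_mul]
        linarith
    simpa only [map_add, map_sub, map_smul, smul_eq_mul] using key
  have key := hB ((C * A p + s * A (fun t => p t * f t * g t * h t)) • q +
      s • (A (fun t => p t * f t) • (fun t => q t * g t * h t) +
      A (fun t => p t * g t) • (fun t => q t * f t * h t) +
      A (fun t => p t * h t) • (fun t => q t * f t * g t) -
      A (fun t => p t * f t * g t) • (fun t => q t * h t) -
      A (fun t => p t * f t * h t) • (fun t => q t * g t) -
      A (fun t => p t * g t * h t) • (fun t => q t * f t) -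
      A p • (fun t => q t * f t * g t * h t))) fun y => by
        have := mul_nonneg (hq y) (inner y)
        simp only [Pi.add_apply, Pi.sub_apply, Pi.smul_apply, smul_eq_mul]
        linarith
  simp only [map_add, map_sub, map_smul, smul_eq_mul] at key
  linarith

/-- A functional preserving binary linear combinations, as a linear map. -/
def linearMapOfCombination {E : Type*} (A : (E → ℝ) → ℝ)
    (hA : ∀ (f g : E → ℝ) (a b : ℝ), A (fun t => a * f t + b * g t) = a * A f + b * A g) :
    (E → ℝ) →ₗ[ℝ] ℝ where
  toFun := A
  map_add' f g := by simpa [Pi.add_def] using hA f g 1 1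
  map_smul' a f := by simpa [Pi.smul_def] using hA f f a 0

theorem stmt_16 {E : Type*} [Nonempty E]
    (A B : (E → ℝ) → ℝ)
    (hAlin : ∀ (f g : E → ℝ) (a b : ℝ), A (fun t => a * f t + b * g t) = a * A f + b * A g)
    (hAmono : ∀ f : E → ℝ, (∀ t, (0:ℝ) ≤ f t) → 0 ≤ A f)
    (hBlin : ∀ (f g : E → ℝ) (a b : ℝ), B (fun t => a * f t + b * g t) = a * B f + b * B g)
    (hBmono : ∀ f : E → ℝ, (∀ t, (0:ℝ) ≤ f t) → 0 ≤ B f)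
    (p q : E → ℝ) (hp : ∀ t, 0 ≤ p t) (hq : ∀ t, 0 ≤ q t)
    (m M n N k K : ℝ) (f g h : E → ℝ)
    (hf : ∀ x, m ≤ f x ∧ f x ≤ M)
    (hg : ∀ x, n ≤ g x ∧ g x ≤ N)
    (hh : ∀ x, k ≤ h x ∧ h x ≤ K) :
    |A (fun t => p t * f t * g t * h t) * B q +
      A (fun t => p t * f t) * B (fun t => q t * g t * h t) +
      A (fun t => p t * g t) * B (fun t => q t * f t * h t) +
      A (fun t => p t * h t) * B (fun t => q t * f t * g t) -
      A (fun t => p t * f t * g t) * B (fun t => q t * h t) -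
      A (fun t => p t * f t * h t) * B (fun t => q t * g t) -
      A (fun t => p t * g t * h t) * B (fun t => q t * f t) -
      A p * B (fun t => q t * f t * g t * h t)| ≤
    (M - m) * (N - n) * (K - k) * A p * B q := by
  have bound (x y : E) :
      |(f x - f y) * (g x - g y) * (h x - h y)| ≤ (M - m) * (N - n) * (K - k) := by
    have hfd : |f x - f y| ≤ M - m := abs_sub_le_of_le_of_le (hf x).1 (hf x).2 (hf y).1 (hf y).2
    have hgd : |g x - g y| ≤ N - n := abs_sub_le_of_le_of_le (hg x).1 (hg x).2 (hg y).1 (hg y).2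
    have hhd : |h x - h y| ≤ K - k := abs_sub_le_of_le_of_le (hh x).1 (hh x).2 (hh y).1 (hh y).2
    have hM : 0 ≤ M - m := (abs_nonneg _).trans hfd
    have hN : 0 ≤ N - n := (abs_nonneg _).trans hgd
    rw [abs_mul, abs_mul]
    gcongr
  have key (s : ℝ) := nonneg_triple_difference (linearMapOfCombination A hAlin)
    (linearMapOfCombination B hBlin) hAmono hBmono p q f g h hp hq
    ((M - m) * (N - n) * (K - k)) s
  have upper := key (-1) fun x y => by linarith [(abs_le.1 (bound x y)).2]
  have lower := key 1 fun x y => by linarith [(abs_le.1 (bound x y)).1]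
  simp only [linearMapOfCombination, LinearMap.coe_mk, AddHom.coe_mk] at upper lower
  rw [abs_le]
  constructor <;> linarith
end

section
/- Let E be a nonempty set and let A, B : (E → ℝ) → ℝ be isotonic linear functionals. Let p, q : E → ℝ be non-negative functions, let M₁, M₂, M₃ ≥ 0 be real numbers, and let g, f₁, f₂, f₃ : E → ℝ satisfy |fᵢ(x)−fᵢ(y)| ≤ Mᵢ·|g(x)−g(y)| for all x, y ∈ E and i = 1, 2, 3. Then |A(p·f₁·f₂·f₃)·B(q) + A(p·f₁)·B(q·f₂·f₃) + A(p·f₂)·B(q·f₁·f₃) + A(p·f₃)·B(q·f₁·f₂) − A(p·f₁·f₂)·B(q·f₃) − A(p·f₁·f₃)·B(q·f₂) − A(p·f₂·f₃)·B(q·f₁) − A(p)·B(q·f₁·f₂·f₃)| ≤ M₁·M₂·M₃·B(y ↦ A(x ↦ p(x)·q(y)·|g(x)−g(y)|³)). -/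
/-- A functional preserving all two-term linear combinations is a linear map. -/
lemma exists_linearMap_eq {E : Type*} {A : (E → ℝ) → ℝ}
    (hA : ∀ (f g : E → ℝ) (a b : ℝ), A (fun t => a * f t + b * g t) = a * A f + b * A g) :
    ∃ L : (E → ℝ) →ₗ[ℝ] ℝ, ⇑L = A := by
  refine ⟨{ toFun := A, map_add' := fun f g => ?_, map_smul' := fun c f => ?_ }, rfl⟩
  · simpa [Pi.add_def] using hA f g 1 1
  · simpa [Pi.smul_def] using hA f f c 0

lemma LinearMap.abs_apply_le_of_abs_le {E : Type*} (L : (E → ℝ) →ₗ[ℝ] ℝ)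
    (hL : ∀ f : E → ℝ, (∀ t, 0 ≤ f t) → 0 ≤ L f) {h k : E → ℝ} (hk : ∀ t, |h t| ≤ k t) :
    |L h| ≤ L k := by
  have h₁ := hL (k - h) fun t => sub_nonneg.2 (abs_le.1 (hk t)).2
  have h₂ := hL (k + h) fun t => by
    have := (abs_le.1 (hk t)).1
    simp only [Pi.add_apply]
    linarith
  rw [map_sub] at h₁
  rw [map_add] at h₂
  exact abs_le.2 ⟨by linarith, by linarith⟩

theorem stmt_17 {E : Type*} [Nonempty E]
    (A B : (E → ℝ) → ℝ)
    (hAlin : ∀ (f g : E → ℝ) (a b : ℝ), A (fun t => a * f t + b * g t) = a * A f + b * A g)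
    (hAmono : ∀ f : E → ℝ, (∀ t, (0:ℝ) ≤ f t) → 0 ≤ A f)
    (hBlin : ∀ (f g : E → ℝ) (a b : ℝ), B (fun t => a * f t + b * g t) = a * B f + b * B g)
    (hBmono : ∀ f : E → ℝ, (∀ t, (0:ℝ) ≤ f t) → 0 ≤ B f)
    (p q : E → ℝ) (hp : ∀ t, 0 ≤ p t) (hq : ∀ t, 0 ≤ q t)
    (M₁ M₂ M₃ : ℝ) (hM₁ : 0 ≤ M₁) (hM₂ : 0 ≤ M₂) (hM₃ : 0 ≤ M₃)
    (g f₁ f₂ f₃ : E → ℝ)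
    (hf₁ : ∀ x y, |f₁ x - f₁ y| ≤ M₁ * |g x - g y|)
    (hf₂ : ∀ x y, |f₂ x - f₂ y| ≤ M₂ * |g x - g y|)
    (hf₃ : ∀ x y, |f₃ x - f₃ y| ≤ M₃ * |g x - g y|) :
    |A (fun t => p t * f₁ t * f₂ t * f₃ t) * B q +
      A (fun t => p t * f₁ t) * B (fun t => q t * f₂ t * f₃ t) +
      A (fun t => p t * f₂ t) * B (fun t => q t * f₁ t * f₃ t) +
      A (fun t => p t * f₃ t) * B (fun t => q t * f₁ t * f₂ t) -
      A (fun t => p t * f₁ t * f₂ t) * B (fun t => q t * f₃ t) -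
      A (fun t => p t * f₁ t * f₃ t) * B (fun t => q t * f₂ t) -
      A (fun t => p t * f₂ t * f₃ t) * B (fun t => q t * f₁ t) -
      A p * B (fun t => q t * f₁ t * f₂ t * f₃ t)| ≤
    M₁ * M₂ * M₃ * B (fun y => A (fun x => p x * q y * |g x - g y| ^ 3)) := by
  obtain ⟨A, rfl⟩ := exists_linearMap_eq hAlin
  obtain ⟨B, rfl⟩ := exists_linearMap_eq hBlin
  have inner_eq (y : E) :
      A (fun x => p x * q y * ((f₁ x - f₁ y) * (f₂ x - f₂ y) * (f₃ x - f₃ y))) =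
        A (fun t => p t * f₁ t * f₂ t * f₃ t) * q y +
        A (fun t => p t * f₁ t) * (q y * f₂ y * f₃ y) +
        A (fun t => p t * f₂ t) * (q y * f₁ y * f₃ y) +
        A (fun t => p t * f₃ t) * (q y * f₁ y * f₂ y) -
        A (fun t => p t * f₁ t * f₂ t) * (q y * f₃ y) -
        A (fun t => p t * f₁ t * f₃ t) * (q y * f₂ y) -
        A (fun t => p t * f₂ t * f₃ t) * (q y * f₁ y) -
        A p * (q y * f₁ y * f₂ y * f₃ y) := by
    have : (fun x => p x * q y * ((f₁ x - f₁ y) * (f₂ x - f₂ y) * (f₃ x - f₃ y))) =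
        q y • (fun t => p t * f₁ t * f₂ t * f₃ t) +
        (q y * f₂ y * f₃ y) • (fun t => p t * f₁ t) +
        (q y * f₁ y * f₃ y) • (fun t => p t * f₂ t) +
        (q y * f₁ y * f₂ y) • (fun t => p t * f₃ t) -
        (q y * f₃ y) • (fun t => p t * f₁ t * f₂ t) -
        (q y * f₂ y) • (fun t => p t * f₁ t * f₃ t) -
        (q y * f₁ y) • (fun t => p t * f₂ t * f₃ t) -
        (q y * f₁ y * f₂ y * f₃ y) • p := by
      ext x
      simp only [Pi.add_apply, Pi.sub_apply, Pi.smul_apply, smul_eq_mul]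
      ring
    rw [this]
    simp only [map_add, map_sub, map_smul, smul_eq_mul]
    ring
  have iterated_eq :
      B (fun y => A (fun x =>
        p x * q y * ((f₁ x - f₁ y) * (f₂ x - f₂ y) * (f₃ x - f₃ y)))) =
      A (fun t => p t * f₁ t * f₂ t * f₃ t) * B q +
      A (fun t => p t * f₁ t) * B (fun t => q t * f₂ t * f₃ t) +
      A (fun t => p t * f₂ t) * B (fun t => q t * f₁ t * f₃ t) +
      A (fun t => p t * f₃ t) * B (fun t => q t * f₁ t * f₂ t) -
      A (fun t => p t * f₁ t * f₂ t) * B (fun t => q t * f₃ t) -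
      A (fun t => p t * f₁ t * f₃ t) * B (fun t => q t * f₂ t) -
      A (fun t => p t * f₂ t * f₃ t) * B (fun t => q t * f₁ t) -
      A p * B (fun t => q t * f₁ t * f₂ t * f₃ t) := by
    simp only [inner_eq, ← smul_eq_mul (A _), ← map_smul, ← map_add, ← map_sub]
    rfl
  rw [← iterated_eq, ← smul_eq_mul (M₁ * M₂ * M₃), ← map_smul]
  refine B.abs_apply_le_of_abs_le hBmono fun y => ?_
  rw [Pi.smul_apply, ← map_smul]
  refine A.abs_apply_le_of_abs_le hAmono fun x => ?_
  rw [Pi.smul_apply, smul_eq_mul, abs_mul, abs_of_nonneg (mul_nonneg (hp x) (hq y)), abs_mul,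
    abs_mul]
  calc p x * q y * (|f₁ x - f₁ y| * |f₂ x - f₂ y| * |f₃ x - f₃ y|)
      ≤ p x * q y * ((M₁ * |g x - g y|) * (M₂ * |g x - g y|) * (M₃ * |g x - g y|)) := by
        have := mul_nonneg (hp x) (hq y)
        gcongr
        exacts [hf₁ x y, hf₂ x y, hf₃ x y]
    _ = M₁ * M₂ * M₃ * (p x * q y * |g x - g y| ^ 3) := by ring
end

section
/- Let E be a nonempty set and let A, B : (E → ℝ) → ℝ be isotonic linear functionals. Let p, q, r : E → ℝ be non-negative functions and let f, g : E → ℝ be similarly ordered functions. Then A(p)·(2·A(q)·B(r·f·g) + A(r)·B(q·f·g) + B(r)·A(q·f·g)) + A(p·f·g)·(A(q)·B(r) + A(r)·B(q)) ≥ A(p)·(A(q·f)·B(r·g) + A(q·g)·B(r·f)) + A(q)·(A(p·f)·B(r·g) + A(p·g)·B(r·f)) + A(r)·(A(p·f)·B(q·g) + A(p·g)·B(q·f)). If f and g are oppositely ordered, then the reversed inequality holds. -/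
theorem map_linear_combination_four {E : Type*} {A : (E → ℝ) → ℝ}
    (hA : ∀ (f g : E → ℝ) (a b : ℝ), A (fun t => a * f t + b * g t) = a * A f + b * A g)
    (f₁ f₂ f₃ f₄ : E → ℝ) (a b c d : ℝ) :
    A (fun t => a * f₁ t + b * f₂ t + c * f₃ t + d * f₄ t) =
      a * A f₁ + b * A f₂ + c * A f₃ + d * A f₄ := by
  have h := hA (fun t => a * f₁ t + b * f₂ t) (fun t => c * f₃ t + d * f₄ t) 1 1
  simp only [one_mul, ← add_assoc] at h
  rw [h, hA, hA]
  ring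

/-- A Chebyshev-type inequality for two isotonic linear functionals. Taking `s = 1` treats
similarly ordered functions, and `s = -1` oppositely ordered ones. -/
theorem chebyshev_two_functionals {E : Type*} {A B : (E → ℝ) → ℝ}
    (hAlin : ∀ (f g : E → ℝ) (a b : ℝ), A (fun t => a * f t + b * g t) = a * A f + b * A g)
    (hAmono : ∀ f : E → ℝ, (∀ t, (0 : ℝ) ≤ f t) → 0 ≤ A f)
    (hBlin : ∀ (f g : E → ℝ) (a b : ℝ), B (fun t => a * f t + b * g t) = a * B f + b * B g)
    (hBmono : ∀ f : E → ℝ, (∀ t, (0 : ℝ) ≤ f t) → 0 ≤ B f)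
    {u v f g : E → ℝ} (hu : ∀ t, 0 ≤ u t) (hv : ∀ t, 0 ≤ v t) (s : ℝ)
    (hfg : ∀ x y, 0 ≤ s * ((f x - f y) * (g x - g y))) :
    0 ≤ s * (A u * B (fun t => v t * f t * g t) + A (fun t => u t * f t * g t) * B v -
      A (fun t => u t * f t) * B (fun t => v t * g t) -
      A (fun t => u t * g t) * B (fun t => v t * f t)) := by
  have hA (y : E) : 0 ≤ s * f y * g y * A u + s * A (fun t => u t * f t * g t) +
      -s * g y * A (fun t => u t * f t) + -s * f y * A (fun t => u t * g t) := by
    rw [← map_linear_combination_four hAlin]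
    refine hAmono _ fun x => ?_
    linarith [mul_nonneg (hu x) (hfg x y)]
  have hB : 0 ≤ s * A u * B (fun t => v t * f t * g t) +
      s * A (fun t => u t * f t * g t) * B v +
      -s * A (fun t => u t * f t) * B (fun t => v t * g t) +
      -s * A (fun t => u t * g t) * B (fun t => v t * f t) := by
    rw [← map_linear_combination_four hBlin]
    refine hBmono _ fun y => ?_
    linarith [mul_nonneg (hv y) (hA y)]
  linarith

theorem stmt_18 {E : Type*} [Nonempty E]
    (A B : (E → ℝ) → ℝ)
    (hAlin : ∀ (f g : E → ℝ) (a b : ℝ), A (fun t => a * f t + b * g t) = a * A f + b * A g)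
    (hAmono : ∀ f : E → ℝ, (∀ t, (0:ℝ) ≤ f t) → 0 ≤ A f)
    (hBlin : ∀ (f g : E → ℝ) (a b : ℝ), B (fun t => a * f t + b * g t) = a * B f + b * B g)
    (hBmono : ∀ f : E → ℝ, (∀ t, (0:ℝ) ≤ f t) → 0 ≤ B f)
    (p q r : E → ℝ) (hp : ∀ t, 0 ≤ p t) (hq : ∀ t, 0 ≤ q t) (hr : ∀ t, 0 ≤ r t)
    (f g : E → ℝ) :
    ((∀ x y, 0 ≤ (f x - f y) * (g x - g y)) →
      A p * (2 * A q * B (fun t => r t * f t * g t) +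
          A r * B (fun t => q t * f t * g t) + B r * A (fun t => q t * f t * g t)) +
        A (fun t => p t * f t * g t) * (A q * B r + A r * B q) ≥
      A p * (A (fun t => q t * f t) * B (fun t => r t * g t) +
          A (fun t => q t * g t) * B (fun t => r t * f t)) +
        A q * (A (fun t => p t * f t) * B (fun t => r t * g t) +
          A (fun t => p t * g t) * B (fun t => r t * f t)) +
        A r * (A (fun t => p t * f t) * B (fun t => q t * g t) +
          A (fun t => p t * g t) * B (fun t => q t * f t))) ∧
    ((∀ x y, (f x - f y) * (g x - g y) ≤ 0) →
      A p * (2 * A q * B (fun t => r t * f t * g t) +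
          A r * B (fun t => q t * f t * g t) + B r * A (fun t => q t * f t * g t)) +
        A (fun t => p t * f t * g t) * (A q * B r + A r * B q) ≤
      A p * (A (fun t => q t * f t) * B (fun t => r t * g t) +
          A (fun t => q t * g t) * B (fun t => r t * f t)) +
        A q * (A (fun t => p t * f t) * B (fun t => r t * g t) +
          A (fun t => p t * g t) * B (fun t => r t * f t)) +
        A r * (A (fun t => p t * f t) * B (fun t => q t * g t) +
          A (fun t => p t * g t) * B (fun t => q t * f t))) := by
  refine ⟨fun hfg => ?_, fun hfg => ?_⟩
  · have key {u v : E → ℝ} (hu : ∀ t, 0 ≤ u t) (hv : ∀ t, 0 ≤ v t) :=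
      chebyshev_two_functionals (f := f) (g := g) hAlin hAmono hBlin hBmono hu hv 1
        fun x y => by linarith [hfg x y]
    linarith [mul_nonneg (hAmono p hp) (key hq hr), mul_nonneg (hAmono q hq) (key hp hr),
      mul_nonneg (hAmono r hr) (key hp hq)]
  · have key {u v : E → ℝ} (hu : ∀ t, 0 ≤ u t) (hv : ∀ t, 0 ≤ v t) :=
      chebyshev_two_functionals (f := f) (g := g) hAlin hAmono hBlin hBmono hu hv (-1)
        fun x y => by linarith [hfg x y]
    linarith [mul_nonneg (hAmono p hp) (key hq hr), mul_nonneg (hAmono q hq) (key hp hr),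
      mul_nonneg (hAmono r hr) (key hp hq)]
end
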